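/- Let r ≥ 1 and let M be an r×r symmetric positive definite integer matrix with all diagonal entries even. Then there exist rational numbers α, β, γ with 2·β ∈ ℤ and 12·γ ∈ ℤ such that for every integer d ≥ 1 and every finite set K ⊆ ℤ^r containing exactly one element of each coset of the subgroup dMℤ^r = {dMk : k ∈ ℤ^r} in ℤ^r, the rational number Σ_{k∈K} (1/(2d))·kᵀM⁻¹k − (α·d^(r+1) + β·d^r + γ·d^(r−1)) is an integer. -/

import Mathlib

open Matrix
open scoped BigOperators

theorem tv {V ι κ : Type*} [AddCommGroup V] (L : AddSubgroup V) (s : Finset ι) (t : Finset κ)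
    (φ : ι → V) (ψ : κ → V)
    (hs : ∀ v, ∃! i, i ∈ s ∧ v - φ i ∈ L) (ht : ∀ v, ∃! i, i ∈ t ∧ v - ψ i ∈ L)
    (F : V → ℚ) (hF : ∀ v w, v - w ∈ L → ∃ n : ℤ, F v - F w = n) :
    ∃ n : ℤ, ∑ i ∈ s, F (φ i) - ∑ j ∈ t, F (ψ j) = n := by
  choose e he he' using fun v => (ht v).exists
  have h2 : ∑ j ∈ t, F (ψ j) = ∑ i ∈ s, F (ψ (e (φ i))) := by
    symm
    refine Finset.sum_bij (fun i _ => e (φ i)) (fun i _ => he _) ?_ ?_ (fun _ _ => rfl)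
    · intro i hi i' hi' h
      refine (hs (φ i)).unique ⟨hi, by simp [L.zero_mem]⟩ ⟨hi', ?_⟩
      have h3 := L.sub_mem (he' (φ i)) (he' (φ i'))
      simp only [h] at h3
      simpa using h3
    · intro j hj
      obtain ⟨i, hi, hi'⟩ := (hs (ψ j)).exists
      refine ⟨i, hi, (ht (φ i)).unique ⟨he _, he' _⟩ ⟨hj, ?_⟩⟩
      simpa using L.neg_mem hi'
  rw [h2, ← Finset.sum_sub_distrib]
  choose m hm using fun i => hF _ _ (he' (φ i))
  exact ⟨∑ i ∈ s, m i, by push_cast; exact Finset.sum_congr rfl fun i _ => hm i⟩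

theorem even_sum {r : ℕ} (A : Fin r → Fin r → ℤ) (hs : ∀ i j, A i j = A j i)
    (he : ∀ i, Even (A i i)) : ∃ m : ℤ, ∑ i, ∑ j, A i j = 2 * m := by
  rw [← Fintype.sum_prod_type']
  have : ((∑ p : Fin r × Fin r, A p.1 p.2 : ℤ) : ZMod 2) = 0 := by
    push_cast
    refine Finset.sum_involution (fun p _ => (p.2, p.1)) ?_ ?_ ?_ ?_
    · rintro ⟨i, j⟩ _
      simp only [hs j i]
      exact CharTwo.add_self_eq_zero _
    · rintro ⟨i, j⟩ _ h h2
      simp only [Prod.mk.injEq] at h2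
      obtain ⟨rfl, _⟩ := h2
      exact h ((ZMod.intCast_zmod_eq_zero_iff_dvd _ 2).2 (he _).two_dvd)
    · simp
    · simp
  exact (ZMod.intCast_zmod_eq_zero_iff_dvd _ 2).1 this

theorem sumQ1 (n : ℕ) : ∑ y ∈ Finset.range n, (y : ℚ) = n * ((n - 1) / 2) := by
  induction n with
  | zero => simp
  | succ k ih => rw [Finset.sum_range_succ, ih]; push_cast; ring
theorem sumQ2 (n : ℕ) : ∑ y ∈ Finset.range n, (y : ℚ) * y = n * ((n - 1) * (2 * n - 1) / 6) := by
  induction n with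
  | zero => simp
  | succ k ih => rw [Finset.sum_range_succ, ih]; push_cast; ring

/-- product formula for second moments over a box -/
theorem box2 {ι : Type*} [Fintype ι] [DecidableEq ι] (n : ι → ℕ) (i j : ι) :
    ∑ x ∈ Fintype.piFinset (fun k => Finset.range (n k)), (x i : ℚ) * x j =
    ∏ k, ∑ y ∈ Finset.range (n k), (if k = i then (y : ℚ) else 1) * (if k = j then (y : ℚ) else 1) := by
  rw [Finset.prod_univ_sum]
  refine Finset.sum_congr rfl fun x _ => ?_
  rw [Finset.prod_mul_distrib]
  simp

theorem box1 {ι : Type*} [Fintype ι] [DecidableEq ι] (n : ι → ℕ) (i : ι) :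
    ∑ x ∈ Fintype.piFinset (fun k => Finset.range (n k)), (x i : ℚ) =
    ∏ k, ∑ y ∈ Finset.range (n k), (if k = i then (y : ℚ) else 1) := by
  rw [Finset.prod_univ_sum]
  refine Finset.sum_congr rfl fun x _ => ?_
  simp

theorem box2_int {ι : Type*} [Fintype ι] [DecidableEq ι] (n : ι → ℕ) (i j : ι) :
    ∃ m : ℤ, 6 * ∑ x ∈ Fintype.piFinset (fun k => Finset.range (n k)), (x i : ℚ) * x j = n i * m := by
  rw [box2, ← Finset.mul_prod_erase _ _ (Finset.mem_univ i), ← mul_assoc]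
  have h1 : ∃ m : ℤ, 6 * ∑ y ∈ Finset.range (n i), (if i = i then (y : ℚ) else 1) * (if i = j then (y : ℚ) else 1) = n i * m := by
    by_cases h : i = j
    · simp only [h, if_true, sumQ2]
      exact ⟨(n j - 1) * (2 * n j - 1), by push_cast; ring⟩
    · simp only [h, if_true, if_false, mul_one, sumQ1]
      exact ⟨3 * (n i - 1), by push_cast; ring⟩
  obtain ⟨m, hm⟩ := h1
  rw [hm]
  refine ⟨m * ∏ k ∈ Finset.univ.erase i, ∑ y ∈ Finset.range (n k), (if k = i then (y : ℤ) else 1) * (if k = j then (y : ℤ) else 1), ?_⟩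
  push_cast
  ring

theorem cube1 (r d : ℕ) (i : Fin r) :
    ∑ x ∈ Fintype.piFinset (fun _ : Fin r => Finset.range d), (x i : ℚ) = d ^ r * ((d - 1) / 2) := by
  rw [box1]
  have : ∀ k : Fin r, ∑ y ∈ Finset.range d, (if k = i then (y : ℚ) else 1) =
      d * (if k = i then ((d : ℚ) - 1) / 2 else 1) := by
    intro k; split_ifs <;> simp [sumQ1]
  simp_rw [this, Finset.prod_mul_distrib]
  simp

theorem cube2 (r d : ℕ) (i j : Fin r) :
    ∑ x ∈ Fintype.piFinset (fun _ : Fin r => Finset.range d), (x i : ℚ) * x j =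
     d ^ r * ((d - 1) ^ 2 / 4) +
     if i = j then (d : ℚ) ^ r * ((d - 1) * (2 * d - 1) / 6 - (d - 1) ^ 2 / 4) else 0 := by
  rw [box2]
  by_cases h : i = j
  · subst h
    have : ∀ k : Fin r, ∑ y ∈ Finset.range d, (if k = i then (y : ℚ) else 1) * (if k = i then (y : ℚ) else 1) =
      d * (if k = i then ((d : ℚ) - 1) * (2 * d - 1) / 6 else 1) := by
      intro k; split_ifs <;> simp [sumQ2]
    simp_rw [this, Finset.prod_mul_distrib]
    simp
    ring
  · have : ∀ k : Fin r, ∑ y ∈ Finset.range d, (if k = i then (y : ℚ) else 1) * (if k = j then (y : ℚ) else 1) =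
      d * ((if k = i then ((d : ℚ) - 1) / 2 else 1) * (if k = j then ((d : ℚ) - 1) / 2 else 1)) := by
      intro k
      split_ifs with h1 h2 h2
      · exact absurd (h1.symm.trans h2) h
      all_goals simp [sumQ1]
    simp_rw [this, Finset.prod_mul_distrib]
    simp only [h, if_false, add_zero, Finset.prod_const, Finset.card_univ, Fintype.card_fin,
      Finset.prod_ite_eq', Finset.mem_univ, if_true]
    ring

theorem smith (r : ℕ) (M : Matrix (Fin r) (Fin r) ℤ) (hM : Function.Injective M.mulVec) :
    ∃ (n : Fin r → ℕ) (e : Fin r → (Fin r → ℤ)),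
      (∀ i, ∃ u, (n i : ℤ) • e i = M.mulVec u) ∧
      ∀ v : Fin r → ℤ, ∃! x : Fin r → ℕ, x ∈ Fintype.piFinset (fun k => Finset.range (n k)) ∧
        ∃ u, v - ∑ i, (x i : ℤ) • e i = M.mulVec u := by
  have hrank : Module.finrank ℤ (LinearMap.range M.mulVecLin) = Module.finrank ℤ (Fin r → ℤ) :=
    LinearMap.finrank_range_of_inj hM
  obtain ⟨b, a, ab, hab⟩ := Submodule.exists_smith_normal_form_of_rank_eq
    (Pi.basisFun ℤ (Fin r)) hrank
  have ha : ∀ i, a i ≠ 0 := by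
    intro i hi
    apply ab.ne_zero i
    apply Subtype.coe_injective
    simp [hab, hi]
  have key : ∀ w, (∃ u, w = M.mulVec u) ↔ ∀ i, a i ∣ b.repr w i := by
    intro w
    constructor
    · rintro ⟨u, rfl⟩ i
      have h1 := ab.sum_repr ⟨M.mulVec u, ⟨u, rfl⟩⟩
      have h2 := congrArg Subtype.val h1
      simp only [Submodule.coe_sum, Submodule.coe_smul, hab] at h2
      rw [← h2]
      simp only [smul_smul]
      rw [b.repr_sum_self]
      exact Dvd.intro_left _ rfl
    · intro h
      choose c hc using h
      have : w ∈ LinearMap.range M.mulVecLin := by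
        rw [← b.sum_repr w]
        refine Submodule.sum_mem _ fun i _ => ?_
        rw [hc, mul_comm, mul_smul, ← hab]
        exact Submodule.smul_mem _ _ (ab i).2
      obtain ⟨u, hu⟩ := this
      exact ⟨u, hu.symm⟩
  refine ⟨fun i => (a i).natAbs, b, ?_, ?_⟩
  · intro i
    rw [key]
    intro j
    rw [map_zsmul, Finsupp.smul_apply, b.repr_self, Finsupp.single_apply]
    split_ifs with h
    · subst h
      rw [smul_eq_mul, mul_one]
      exact Int.dvd_natAbs_self
    · simp
  · intro v
    simp only [key, map_sub, Finsupp.sub_apply, b.repr_sum_self, Fintype.mem_piFinset,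
      Finset.mem_range]
    refine ⟨fun i => (b.repr v i % a i).toNat, ⟨fun i => ?_, fun i => ?_⟩, ?_⟩
    · have := Int.emod_nonneg (b.repr v i) (ha i)
      have := Int.emod_lt_abs (b.repr v i) (ha i)
      rw [Int.abs_eq_natAbs] at this
      show (b.repr v i % a i).toNat < _
      omega
    · have := Int.emod_nonneg (b.repr v i) (ha i)
      rw [Int.toNat_of_nonneg this]
      exact Int.dvd_self_sub_emod
    · rintro x ⟨hx, hx'⟩
      funext i
      have h1 : b.repr v i % a i = (x i : ℤ) % a i :=
        (Int.emod_emod_of_dvd _ dvd_rfl).symm.trans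
          (by rw [Int.emod_emod_of_dvd _ dvd_rfl]; exact Int.emod_eq_emod_iff_emod_sub_eq_zero.2 (Int.emod_eq_zero_of_dvd (hx' i)))
      have h2 : (x i : ℤ) % a i = x i := by
        rw [← Int.emod_abs]
        exact Int.emod_eq_of_lt (by positivity) (by rw [Int.abs_eq_natAbs]; have := hx i; omega)
      simp [h1, h2]

theorem trans2 (r : ℕ) (M : Matrix (Fin r) (Fin r) ℤ) (hM : Function.Injective M.mulVec)
    (s : Finset (Fin r → ℕ)) (φ : (Fin r → ℕ) → (Fin r → ℤ))
    (hs : ∀ v : Fin r → ℤ, ∃! x, x ∈ s ∧ ∃ u, v - φ x = M.mulVec u) (d : ℕ) (hd : 1 ≤ d) :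
    ∀ v : Fin r → ℤ, ∃! p : (Fin r → ℕ) × (Fin r → ℕ),
      p ∈ s ×ˢ Fintype.piFinset (fun _ : Fin r => Finset.range d) ∧
      ∃ u, v - (φ p.1 + M.mulVec (fun i => (p.2 i : ℤ))) = (d : ℤ) • M.mulVec u := by
  intro v
  obtain ⟨x, ⟨hx, u, hu⟩, hux⟩ := hs v
  have hd0 : (d : ℤ) ≠ 0 := by omega
  refine ⟨(x, fun i => (u i % d).toNat), ⟨?_, fun i => u i / d, ?_⟩, ?_⟩
  · simp only [Finset.mem_product, hx, Fintype.mem_piFinset, Finset.mem_range, true_and]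
    intro i
    have := Int.emod_nonneg (u i) hd0
    have := Int.emod_lt_of_pos (u i) (show (0 : ℤ) < d by omega)
    omega
  · rw [← sub_sub, hu, ← Matrix.mulVec_smul, ← Matrix.mulVec_sub]
    congr 1
    funext i
    have := Int.emod_nonneg (u i) hd0
    simp only [Pi.sub_apply, Pi.smul_apply, smul_eq_mul, Int.toNat_of_nonneg this]
    have := Int.emod_add_mul_ediv (u i) d
    linarith
  · rintro ⟨y, j⟩ ⟨hy, w, hw⟩
    simp only [Finset.mem_product, Fintype.mem_piFinset, Finset.mem_range] at hy
    simp only at hw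
    have h1 : v - φ y = M.mulVec ((fun i => (j i : ℤ)) + (d : ℤ) • w) := by
      rw [Matrix.mulVec_add, Matrix.mulVec_smul, ← hw]; abel
    obtain rfl : y = x := hux y ⟨hy.1, _, h1⟩
    have h2 := hM (hu.symm.trans h1)
    simp only [Prod.mk.injEq, true_and]
    funext i
    have h3 : u i = j i + d * w i := by rw [h2]; simp
    rw [h3, Int.add_mul_emod_self_left, Int.emod_eq_of_lt (by positivity) (by exact_mod_cast hy.2 i)]
    simp

/-- the integer-bilinear form `k, l ↦ kᵀ M⁻¹ l` -/
noncomputable def BB (r : ℕ) (N : Matrix (Fin r) (Fin r) ℚ) :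
    (Fin r → ℤ) →ₗ[ℤ] (Fin r → ℤ) →ₗ[ℤ] ℚ :=
  LinearMap.mk₂ ℤ (fun k l => (fun i => (k i : ℚ)) ⬝ᵥ N.mulVec (fun i => (l i : ℚ)))
    (by intro a b c; rw [← add_dotProduct]; congr 1; funext i; simp)
    (by intro a b c; rw [← smul_dotProduct]; congr 1; funext i; simp)
    (by intro a b c; rw [← dotProduct_add, ← Matrix.mulVec_add]; congr 2; funext i; simp)
    (by intro a b c; rw [← dotProduct_smul, ← Matrix.mulVec_smul]; congr 2; funext i; simp)

theorem S1_int (r : ℕ) (M : Matrix (Fin r) (Fin r) ℤ)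
    (B : (Fin r → ℤ) →ₗ[ℤ] (Fin r → ℤ) →ₗ[ℤ] ℚ)
    (hB : ∀ k u, B (M.mulVec u) k = ((k ⬝ᵥ u : ℤ) : ℚ))
    (n : Fin r → ℕ) (e : Fin r → (Fin r → ℤ))
    (hn : ∀ i, ∃ u, (n i : ℤ) • e i = M.mulVec u) :
    ∃ m : ℤ, 6 * ∑ x ∈ Fintype.piFinset (fun k => Finset.range (n k)),
      B (∑ i, (x i : ℤ) • e i) (∑ i, (x i : ℤ) • e i) = m := by
  have h1 : ∀ x : Fin r → ℕ, B (∑ i, (x i : ℤ) • e i) (∑ i, (x i : ℤ) • e i) =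
      ∑ i, ∑ j, B (e i) (e j) * ((x i : ℚ) * x j) := by
    intro x
    simp only [map_sum, map_smul, LinearMap.sum_apply, LinearMap.smul_apply]
    simp only [zsmul_eq_mul, Finset.mul_sum]
    rw [Finset.sum_comm]
    refine Finset.sum_congr rfl fun i _ => Finset.sum_congr rfl fun j _ => ?_
    push_cast
    ring
  choose u hu using hn
  choose m hm using box2_int n
  refine ⟨∑ i, ∑ j, (e j ⬝ᵥ u i) * m i j, ?_⟩
  simp only [h1]
  rw [Finset.sum_comm, Finset.mul_sum]
  push_cast
  refine Finset.sum_congr rfl fun i _ => ?_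
  rw [Finset.sum_comm, Finset.mul_sum]
  refine Finset.sum_congr rfl fun j _ => ?_
  rw [← Finset.mul_sum]
  have h2 : (n i : ℚ) * B (e i) (e j) = ((e j ⬝ᵥ u i : ℤ) : ℚ) := by
    rw [← hB, ← hu, map_smul, LinearMap.smul_apply, zsmul_eq_mul]
    simp
  rw [← Int.cast_mul, Int.cast_mul, ← h2]
  linear_combination B (e i) (e j) * hm i j

theorem main_sum (r : ℕ) (hr : 1 ≤ r) (M : Matrix (Fin r) (Fin r) ℤ)
    (B : (Fin r → ℤ) →ₗ[ℤ] (Fin r → ℤ) →ₗ[ℤ] ℚ)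
    (hB : ∀ k u, B (M.mulVec u) k = ((k ⬝ᵥ u : ℤ) : ℚ))
    (hBs : ∀ k l, B k l = B l k)
    (s : Finset (Fin r → ℕ)) (φ : (Fin r → ℕ) → (Fin r → ℤ)) (d : ℕ) (hd : 1 ≤ d)
    (t o : ℤ) (ht : ∑ i, M i i = 2 * t) (ho : ∑ i, ∑ j, M i j = 2 * o) :
    ∑ p ∈ s ×ˢ Fintype.piFinset (fun _ : Fin r => Finset.range d), (1 / (2 * (d : ℚ))) *
      B (φ p.1 + M.mulVec (fun i => (p.2 i : ℤ))) (φ p.1 + M.mulVec (fun i => (p.2 i : ℤ))) =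
    (d : ℚ) ^ (r - 1) * ((∑ x ∈ s, B (φ x) (φ x)) / 2
      + (∑ x ∈ s, ∑ i, (φ x i : ℚ)) * ((d - 1) / 2)
      + s.card * (o * ((d - 1) ^ 2 / 4)
        + t * (((d : ℚ) - 1) * (2 * d - 1) / 6 - (d - 1) ^ 2 / 4))) := by
  have hd0 : (d : ℚ) ≠ 0 := by positivity
  have hpow : (d : ℚ) ^ r = d ^ (r - 1) * d := by
    rw [← pow_succ]; congr 1; omega
  have h1 : ∀ (x j : Fin r → ℕ),
      B (φ x + M.mulVec (fun i => (j i : ℤ))) (φ x + M.mulVec (fun i => (j i : ℤ))) =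
      B (φ x) (φ x) + 2 * (∑ i, (φ x i : ℚ) * j i) + ∑ i, ∑ l, (M i l : ℚ) * ((j i : ℚ) * j l) := by
    intro x j
    simp only [map_add, LinearMap.add_apply, hBs (φ x) (M.mulVec _), hB]
    have : (((M.mulVec (fun i => (j i : ℤ))) ⬝ᵥ (fun i => (j i : ℤ)) : ℤ) : ℚ) =
        ∑ i, ∑ l, (M i l : ℚ) * ((j i : ℚ) * j l) := by
      simp only [dotProduct, Matrix.mulVec, Finset.sum_mul]
      push_cast
      refine Finset.sum_congr rfl fun i _ => Finset.sum_congr rfl fun l _ => ?_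
      ring
    rw [this]
    simp only [dotProduct]
    push_cast
    ring
  have h2 : ∀ x : Fin r → ℕ, ∑ j ∈ Fintype.piFinset (fun _ : Fin r => Finset.range d),
      B (φ x + M.mulVec (fun i => (j i : ℤ))) (φ x + M.mulVec (fun i => (j i : ℤ))) =
      d ^ r * (B (φ x) (φ x) + (∑ i, (φ x i : ℚ)) * (d - 1)
        + (2 * o * ((d - 1) ^ 2 / 4)
        + 2 * t * (((d : ℚ) - 1) * (2 * d - 1) / 6 - (d - 1) ^ 2 / 4))) := by
    intro x
    simp only [h1, Finset.sum_add_distrib, ← Finset.mul_sum]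
    have e1 : ∑ j ∈ Fintype.piFinset (fun _ : Fin r => Finset.range d), ∑ i, (φ x i : ℚ) * j i =
        (∑ i, (φ x i : ℚ)) * (d ^ r * ((d - 1) / 2)) := by
      rw [Finset.sum_comm, Finset.sum_mul]
      refine Finset.sum_congr rfl fun i _ => ?_
      rw [← Finset.mul_sum, cube1]
    have e2 : ∑ j ∈ Fintype.piFinset (fun _ : Fin r => Finset.range d),
        ∑ i, ∑ l, (M i l : ℚ) * ((j i : ℚ) * j l) =
        (∑ i, ∑ l, (M i l : ℚ)) * (d ^ r * ((d - 1) ^ 2 / 4)) +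
        (∑ i, (M i i : ℚ)) *
          ((d : ℚ) ^ r * ((d - 1) * (2 * d - 1) / 6 - (d - 1) ^ 2 / 4)) := by
      rw [Finset.sum_comm, Finset.sum_mul, Finset.sum_mul, ← Finset.sum_add_distrib]
      refine Finset.sum_congr rfl fun i _ => ?_
      rw [Finset.sum_comm]
      simp only [← Finset.mul_sum, cube2, mul_add, Finset.sum_add_distrib, mul_ite, mul_zero,
        Finset.sum_ite_eq, Finset.mem_univ, if_true, ← Finset.sum_mul]
    have ht' : ∑ i, (M i i : ℚ) = 2 * t := by exact_mod_cast ht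
    have ho' : ∑ i, ∑ j, (M i j : ℚ) = 2 * o := by exact_mod_cast ho
    rw [e1, e2, ht', ho']
    simp
    ring
  rw [← Finset.mul_sum, Finset.sum_product]
  simp only [h2]
  rw [← Finset.mul_sum, Finset.sum_add_distrib, Finset.sum_add_distrib, ← Finset.sum_mul,
    Finset.sum_const, hpow, nsmul_eq_mul]
  field_simp

theorem stmt17 (r : ℕ) (hr : 1 ≤ r)
    (M : Matrix (Fin r) (Fin r) ℤ) (hMsymm : M.IsSymm)
    (hMpos : (M.map ((↑) : ℤ → ℝ)).PosDef)
    (hMeven : ∀ i, Even (M i i)) :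
    ∃ α β γ : ℚ, (∃ m : ℤ, 2 * β = (m : ℚ)) ∧ (∃ m : ℤ, 12 * γ = (m : ℚ)) ∧
      ∀ d : ℤ, 1 ≤ d → ∀ K : Finset (Fin r → ℤ),
        (∀ v : Fin r → ℤ, ∃! k, k ∈ K ∧ ∃ u : Fin r → ℤ, v - k = d • M.mulVec u) →
        ∃ n : ℤ,
          (∑ k ∈ K, (1 / (2 * (d : ℚ))) *
              ((fun i => ((k i : ℚ))) ⬝ᵥ
                (M.map ((↑) : ℤ → ℚ))⁻¹.mulVec (fun i => ((k i : ℚ)))))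
            - (α * (d : ℚ) ^ (r + 1) + β * (d : ℚ) ^ r + γ * (d : ℚ) ^ (r - 1)) = (n : ℚ) := by
  have hdet : M.det ≠ 0 := by
    intro h
    have h1 := hMpos.det_pos
    have h2 : (M.map ((↑) : ℤ → ℝ)).det = ((M.det : ℤ) : ℝ) := (Int.cast_det M).symm
    rw [h2, h] at h1
    simp at h1
  have hdetq : IsUnit (M.map ((↑) : ℤ → ℚ)).det := by
    have h2 : (M.map ((↑) : ℤ → ℚ)).det = ((M.det : ℤ) : ℚ) := (Int.cast_det M).symm
    rw [h2, isUnit_iff_ne_zero]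
    exact_mod_cast hdet
  have hinj : Function.Injective M.mulVec := by
    intro a b hab
    rw [← sub_eq_zero]
    exact Matrix.eq_zero_of_mulVec_eq_zero hdet (by rw [Matrix.mulVec_sub, hab, sub_self])
  have hsym : ∀ i j, M i j = M j i := fun i j => hMsymm.apply j i
  obtain ⟨B, hBdef⟩ : ∃ B, B = BB r (M.map ((↑) : ℤ → ℚ))⁻¹ := ⟨_, rfl⟩
  have hBval : ∀ k l, B k l = (fun i => ((k i : ℚ))) ⬝ᵥ
                (M.map ((↑) : ℤ → ℚ))⁻¹.mulVec (fun i => ((l i : ℚ))) := by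
    intro k l; rw [hBdef]; rfl
  have hBs : ∀ k l, B k l = B l k := by
    intro k l
    have hT : ((M.map ((↑) : ℤ → ℚ))⁻¹)ᵀ = (M.map ((↑) : ℤ → ℚ))⁻¹ := by
      rw [Matrix.transpose_nonsing_inv, ← Matrix.transpose_map, hMsymm]
    rw [hBval, hBval, Matrix.dotProduct_mulVec, ← Matrix.mulVec_transpose, hT, dotProduct_comm]
  have hB : ∀ k u, B (M.mulVec u) k = ((k ⬝ᵥ u : ℤ) : ℚ) := by
    intro k u
    rw [hBs, hBval]
    have h1 : (fun i => ((M.mulVec u i : ℤ) : ℚ)) =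
        (M.map ((↑) : ℤ → ℚ)).mulVec (fun i => (u i : ℚ)) := by
      funext i
      simp [Matrix.mulVec, dotProduct]
    rw [h1, Matrix.mulVec_mulVec, Matrix.nonsing_inv_mul _ hdetq, Matrix.one_mulVec]
    simp [dotProduct]
  obtain ⟨o, ho⟩ := even_sum (fun i j => M i j) hsym hMeven
  obtain ⟨t, ht⟩ : ∃ t : ℤ, ∑ i, M i i = 2 * t := by
    choose c hc using fun i => (hMeven i).two_dvd
    exact ⟨∑ i, c i, by rw [Finset.mul_sum]; exact Finset.sum_congr rfl fun i _ => hc i⟩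
  obtain ⟨n, e, hn, hs⟩ := smith r M hinj
  obtain ⟨m, hm⟩ := S1_int r M B hB n e hn
  set s := Fintype.piFinset (fun k => Finset.range (n k)) with hsdef
  set φ : (Fin r → ℕ) → (Fin r → ℤ) := fun x => ∑ i, (x i : ℤ) • e i with hφ
  obtain ⟨c, hc⟩ : ∃ c : ℤ, ∑ x ∈ s, ∑ i, (φ x i : ℚ) = c :=
    ⟨∑ x ∈ s, ∑ i, φ x i, by push_cast; rfl⟩
  obtain ⟨S, hS⟩ : ∃ S : ℚ, ∑ x ∈ s, B (φ x) (φ x) = S := ⟨_, rfl⟩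
  have hm' : 6 * S = m := by rw [← hS]; exact hm
  refine ⟨s.card * (o / 4 + t / 12), c / 2 - s.card * o / 2,
    S / 2 - c / 2 + s.card * (o / 4 - t / 12), ⟨c - s.card * o, by push_cast; ring⟩,
    ⟨m - 6 * c + s.card * (3 * o - t), by push_cast; linear_combination hm'⟩, ?_⟩
  intro d hd K hK
  lift d to ℕ using (by omega)
  have hd1 : 1 ≤ d := by exact_mod_cast hd
  have hd0 : (d : ℚ) ≠ 0 := by positivity
  have hK2 := trans2 r M hinj s φ hs d hd1
  have hL : ∀ w, w ∈ (LinearMap.range ((d : ℤ) • M.mulVecLin)).toAddSubgroup ↔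
      ∃ u, w = (d : ℤ) • M.mulVec u := by
    intro w
    constructor
    · rintro ⟨u, hu⟩
      exact ⟨u, hu.symm⟩
    · rintro ⟨u, hu⟩
      exact ⟨u, hu.symm⟩
  obtain ⟨z, hz⟩ := tv (LinearMap.range ((d : ℤ) • M.mulVecLin)).toAddSubgroup K
    (s ×ˢ Fintype.piFinset (fun _ : Fin r => Finset.range d)) id
    (fun p => φ p.1 + M.mulVec (fun i => (p.2 i : ℤ)))
    (by simpa only [hL, id] using hK) (by simpa only [hL] using hK2)
    (fun v => (1 / (2 * (d : ℚ))) * B v v) (by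
      intro v w hvw
      obtain ⟨u, hu⟩ := (hL _).1 hvw
      obtain ⟨g, hg⟩ := even_sum (fun i j => M i j * (u i * u j))
        (by intro i j; rw [hsym i j]; ring) (fun i => (hMeven i).mul_right _)
      have hg' : (M.mulVec u ⬝ᵥ u) = 2 * g := by
        rw [← hg]
        simp only [dotProduct, Matrix.mulVec, Finset.sum_mul]
        refine Finset.sum_congr rfl fun i _ => Finset.sum_congr rfl fun l _ => ?_
        ring
      obtain rfl : v = w + (d : ℤ) • M.mulVec u := by rw [← hu]; abel
      refine ⟨w ⬝ᵥ u + d * g, ?_⟩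
      simp only [map_add, map_smul, LinearMap.add_apply, LinearMap.smul_apply,
        hBs w (M.mulVec u), hB, hg']
      simp only [zsmul_eq_mul]
      push_cast
      field_simp
      ring)
  refine ⟨z, ?_⟩
  rw [← hz, main_sum r hr M B hB hBs s φ d hd1 t o ht ho, hS, hc]
  simp only [id, hBval]
  have hpow : (d : ℚ) ^ r = d ^ (r - 1) * d := by
    rw [← pow_succ]; congr 1; omega
  simp only [Int.cast_natCast]
  rw [pow_succ, hpow]
  ring
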